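/- arXiv:2509.09017 — 2 statements merged into one kernel-verified Lean document; each statement's English description precedes it below -/
import Mathlib

section
/- The nonzero eigenvalues of the matrix A_x of the Kirchhoff–Love first-order system are ±√(E/(ρ(1-ν²))) (longitudinal wave speed), ±√(E/(4ρ(1+ν))) (shear wave speed), ±√(D/I) (bending wave speed), and ±√(D(1-ν)/(2I)) (twisting wave speed); the remaining two eigenvalues are 0. -/
theorem kl_mul {R : Type*} [CommRing R] (x a1 a2 a3 a4 b1 b2 b3 b4 b5 b6 : R) :
    (!![x, 0, 0, 0, -a1, 0, 0, 0, 0, 0;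
    0, x, 0, 0, 0, 0, -a2, 0, 0, 0;
    0, 0, x, 0, 0, 0, 0, -a3, 0, 0;
    0, 0, 0, x, 0, 0, 0, 0, 0, -a4;
    -b1, 0, 0, 0, x, 0, 0, 0, 0, 0;
    -b2, 0, 0, 0, 0, x, 0, 0, 0, 0;
    0, -b3, 0, 0, 0, 0, x, 0, 0, 0;
    0, 0, -b4, 0, 0, 0, 0, x, 0, 0;
    0, 0, -b5, 0, 0, 0, 0, 0, x, 0;
    0, 0, 0, -b6, 0, 0, 0, 0, 0, x] : Matrix (Fin 10) (Fin 10) R) * !![x, 0, 0, 0, 0, 0, 0, 0, 0, 0;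
    0, x, 0, 0, 0, 0, 0, 0, 0, 0;
    0, 0, x, 0, 0, 0, 0, 0, 0, 0;
    0, 0, 0, x, 0, 0, 0, 0, 0, 0;
    b1, 0, 0, 0, 1, 0, 0, 0, 0, 0;
    b2, 0, 0, 0, 0, 1, 0, 0, 0, 0;
    0, b3, 0, 0, 0, 0, 1, 0, 0, 0;
    0, 0, b4, 0, 0, 0, 0, 1, 0, 0;
    0, 0, b5, 0, 0, 0, 0, 0, 1, 0;
    0, 0, 0, b6, 0, 0, 0, 0, 0, 1] = !![x*x-a1*b1, 0, 0, 0, -a1, 0, 0, 0, 0, 0;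
    0, x*x-a2*b3, 0, 0, 0, 0, -a2, 0, 0, 0;
    0, 0, x*x-a3*b4, 0, 0, 0, 0, -a3, 0, 0;
    0, 0, 0, x*x-a4*b6, 0, 0, 0, 0, 0, -a4;
    0, 0, 0, 0, x, 0, 0, 0, 0, 0;
    0, 0, 0, 0, 0, x, 0, 0, 0, 0;
    0, 0, 0, 0, 0, 0, x, 0, 0, 0;
    0, 0, 0, 0, 0, 0, 0, x, 0, 0;
    0, 0, 0, 0, 0, 0, 0, 0, x, 0;
    0, 0, 0, 0, 0, 0, 0, 0, 0, x] := by
  ext i j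
  fin_cases i <;> fin_cases j <;> simp [Matrix.mul_apply, Fin.sum_univ_succ] <;> ring

theorem kl_detN {R : Type*} [CommRing R] (x b1 b2 b3 b4 b5 b6 : R) :
    Matrix.det (!![x, 0, 0, 0, 0, 0, 0, 0, 0, 0;
    0, x, 0, 0, 0, 0, 0, 0, 0, 0;
    0, 0, x, 0, 0, 0, 0, 0, 0, 0;
    0, 0, 0, x, 0, 0, 0, 0, 0, 0;
    b1, 0, 0, 0, 1, 0, 0, 0, 0, 0;
    b2, 0, 0, 0, 0, 1, 0, 0, 0, 0;
    0, b3, 0, 0, 0, 0, 1, 0, 0, 0;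
    0, 0, b4, 0, 0, 0, 0, 1, 0, 0;
    0, 0, b5, 0, 0, 0, 0, 0, 1, 0;
    0, 0, 0, b6, 0, 0, 0, 0, 0, 1] : Matrix (Fin 10) (Fin 10) R) = x ^ 4 := by
  rw [Matrix.det_of_isLowerTriangular]
  · simp [Fin.prod_univ_succ]
    ring
  · intro i j h
    fin_cases i <;> fin_cases j <;> first | rfl | (exfalso; revert h; decide)

theorem kl_detT {R : Type*} [CommRing R] (x a1 a2 a3 a4 b1 b3 b4 b6 : R) :
    Matrix.det (!![x*x-a1*b1, 0, 0, 0, -a1, 0, 0, 0, 0, 0;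
    0, x*x-a2*b3, 0, 0, 0, 0, -a2, 0, 0, 0;
    0, 0, x*x-a3*b4, 0, 0, 0, 0, -a3, 0, 0;
    0, 0, 0, x*x-a4*b6, 0, 0, 0, 0, 0, -a4;
    0, 0, 0, 0, x, 0, 0, 0, 0, 0;
    0, 0, 0, 0, 0, x, 0, 0, 0, 0;
    0, 0, 0, 0, 0, 0, x, 0, 0, 0;
    0, 0, 0, 0, 0, 0, 0, x, 0, 0;
    0, 0, 0, 0, 0, 0, 0, 0, x, 0;
    0, 0, 0, 0, 0, 0, 0, 0, 0, x] : Matrix (Fin 10) (Fin 10) R) =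
      (x*x-a1*b1)*(x*x-a2*b3)*(x*x-a3*b4)*(x*x-a4*b6)*x^6 := by
  rw [Matrix.det_of_isUpperTriangular]
  · simp [Fin.prod_univ_succ]
    ring
  · intro i j h
    fin_cases i <;> fin_cases j <;> first | rfl | (exfalso; revert h; decide)

theorem kl_ring {R : Type*} [CommRing R] (x a b c d : R) :
    (x*x-a*a)*(x*x-b*b)*(x*x-c*c)*(x*x-d*d)*x^6 =
    (x-a)*((x- -a)*((x-b)*((x- -b)*((x-c)*((x- -c)*((x-d)*((x- -d)*((x-0)*(x-0)))))))))*x^4 := by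
  rw [mul_self_sub_mul_self x a, mul_self_sub_mul_self x b, mul_self_sub_mul_self x c,
    mul_self_sub_mul_self x d, sub_neg_eq_add, sub_neg_eq_add, sub_neg_eq_add, sub_neg_eq_add,
    sub_zero]
  generalize x + a = a1, x - a = a2, x + b = b1, x - b = b2, x + c = c1, x - c = c2,
    x + d = d1, x - d = d2
  ring

theorem kl_det {R : Type*} [CommRing R] [IsDomain R] (x a1 a2 a3 a4 b1 b2 b3 b4 b5 b6 c1 c2 c3 c4 : R) (h1 : a1*b1 = c1*c1)
    (h2 : a2*b3 = c2*c2) (h3 : a3*b4 = c3*c3) (h4 : a4*b6 = c4*c4) (hx : x ≠ 0) :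
    Matrix.det (!![x, 0, 0, 0, -a1, 0, 0, 0, 0, 0;
    0, x, 0, 0, 0, 0, -a2, 0, 0, 0;
    0, 0, x, 0, 0, 0, 0, -a3, 0, 0;
    0, 0, 0, x, 0, 0, 0, 0, 0, -a4;
    -b1, 0, 0, 0, x, 0, 0, 0, 0, 0;
    -b2, 0, 0, 0, 0, x, 0, 0, 0, 0;
    0, -b3, 0, 0, 0, 0, x, 0, 0, 0;
    0, 0, -b4, 0, 0, 0, 0, x, 0, 0;
    0, 0, -b5, 0, 0, 0, 0, 0, x, 0;
    0, 0, 0, -b6, 0, 0, 0, 0, 0, x] : Matrix (Fin 10) (Fin 10) R) =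
      (x-c1)*((x- -c1)*((x-c2)*((x- -c2)*((x-c3)*((x- -c3)*((x-c4)*((x- -c4)*((x-0)*(x-0))))))))) := by
  apply mul_right_cancel₀ (pow_ne_zero 4 hx)
  rw [← kl_ring]
  rw [← kl_detN x b1 b2 b3 b4 b5 b6, ← Matrix.det_mul, kl_mul, kl_detT, h1, h2, h3, h4]

open Polynomial in
theorem kl_charmatrix (a1 a2 a3 a4 b1 b2 b3 b4 b5 b6 : ℂ) :
    Matrix.charmatrix (!![0, 0, 0, 0, a1, 0, 0, 0, 0, 0;
    0, 0, 0, 0, 0, 0, a2, 0, 0, 0;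
    0, 0, 0, 0, 0, 0, 0, a3, 0, 0;
    0, 0, 0, 0, 0, 0, 0, 0, 0, a4;
    b1, 0, 0, 0, 0, 0, 0, 0, 0, 0;
    b2, 0, 0, 0, 0, 0, 0, 0, 0, 0;
    0, b3, 0, 0, 0, 0, 0, 0, 0, 0;
    0, 0, b4, 0, 0, 0, 0, 0, 0, 0;
    0, 0, b5, 0, 0, 0, 0, 0, 0, 0;
    0, 0, 0, b6, 0, 0, 0, 0, 0, 0] : Matrix (Fin 10) (Fin 10) ℂ) = !![X, 0, 0, 0, -C a1, 0, 0, 0, 0, 0;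
    0, X, 0, 0, 0, 0, -C a2, 0, 0, 0;
    0, 0, X, 0, 0, 0, 0, -C a3, 0, 0;
    0, 0, 0, X, 0, 0, 0, 0, 0, -C a4;
    -C b1, 0, 0, 0, X, 0, 0, 0, 0, 0;
    -C b2, 0, 0, 0, 0, X, 0, 0, 0, 0;
    0, -C b3, 0, 0, 0, 0, X, 0, 0, 0;
    0, 0, -C b4, 0, 0, 0, 0, X, 0, 0;
    0, 0, -C b5, 0, 0, 0, 0, 0, X, 0;
    0, 0, 0, -C b6, 0, 0, 0, 0, 0, X] := by
  ext1 i j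
  fin_cases i <;> fin_cases j <;> simp

open Polynomial in
theorem kl_charpoly (a1 a2 a3 a4 b1 b2 b3 b4 b5 b6 c1 c2 c3 c4 : ℂ) (h1 : a1*b1 = c1*c1) (h2 : a2*b3 = c2*c2)
    (h3 : a3*b4 = c3*c3) (h4 : a4*b6 = c4*c4) :
    Matrix.charpoly (!![0, 0, 0, 0, a1, 0, 0, 0, 0, 0;
    0, 0, 0, 0, 0, 0, a2, 0, 0, 0;
    0, 0, 0, 0, 0, 0, 0, a3, 0, 0;
    0, 0, 0, 0, 0, 0, 0, 0, 0, a4;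
    b1, 0, 0, 0, 0, 0, 0, 0, 0, 0;
    b2, 0, 0, 0, 0, 0, 0, 0, 0, 0;
    0, b3, 0, 0, 0, 0, 0, 0, 0, 0;
    0, 0, b4, 0, 0, 0, 0, 0, 0, 0;
    0, 0, b5, 0, 0, 0, 0, 0, 0, 0;
    0, 0, 0, b6, 0, 0, 0, 0, 0, 0] : Matrix (Fin 10) (Fin 10) ℂ) =
      (Multiset.map (fun a => X - C a) {c1, -c1, c2, -c2, c3, -c3, c4, -c4, 0, 0}).prod := by
  have key := kl_det (X : ℂ[X]) (C a1) (C a2) (C a3) (C a4) (C b1) (C b2) (C b3) (C b4) (C b5) (C b6) (C c1) (C c2) (C c3) (C c4)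
    (by rw [← C_mul, h1, C_mul]) (by rw [← C_mul, h2, C_mul])
    (by rw [← C_mul, h3, C_mul]) (by rw [← C_mul, h4, C_mul]) X_ne_zero
  rw [Matrix.charpoly, kl_charmatrix, key]
  simp only [Multiset.insert_eq_cons, Multiset.map_cons, Multiset.map_singleton,
    Multiset.prod_cons, Multiset.prod_singleton, C_neg, C_0]

theorem kl_map (a1 a2 a3 a4 b1 b2 b3 b4 b5 b6 : ℝ) :
    (!![0, 0, 0, 0, a1, 0, 0, 0, 0, 0;
    0, 0, 0, 0, 0, 0, a2, 0, 0, 0;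
    0, 0, 0, 0, 0, 0, 0, a3, 0, 0;
    0, 0, 0, 0, 0, 0, 0, 0, 0, a4;
    b1, 0, 0, 0, 0, 0, 0, 0, 0, 0;
    b2, 0, 0, 0, 0, 0, 0, 0, 0, 0;
    0, b3, 0, 0, 0, 0, 0, 0, 0, 0;
    0, 0, b4, 0, 0, 0, 0, 0, 0, 0;
    0, 0, b5, 0, 0, 0, 0, 0, 0, 0;
    0, 0, 0, b6, 0, 0, 0, 0, 0, 0] : Matrix (Fin 10) (Fin 10) ℝ).map (fun x => (x : ℂ)) =
    !![0, 0, 0, 0, (a1 : ℂ), 0, 0, 0, 0, 0;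
    0, 0, 0, 0, 0, 0, (a2 : ℂ), 0, 0, 0;
    0, 0, 0, 0, 0, 0, 0, (a3 : ℂ), 0, 0;
    0, 0, 0, 0, 0, 0, 0, 0, 0, (a4 : ℂ);
    (b1 : ℂ), 0, 0, 0, 0, 0, 0, 0, 0, 0;
    (b2 : ℂ), 0, 0, 0, 0, 0, 0, 0, 0, 0;
    0, (b3 : ℂ), 0, 0, 0, 0, 0, 0, 0, 0;
    0, 0, (b4 : ℂ), 0, 0, 0, 0, 0, 0, 0;
    0, 0, (b5 : ℂ), 0, 0, 0, 0, 0, 0, 0;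
    0, 0, 0, (b6 : ℂ), 0, 0, 0, 0, 0, 0] := by
  ext1 i j
  fin_cases i <;> fin_cases j <;> simp

theorem stmt1 (ρ I E D ν : ℝ) (hρ : 0 < ρ) (hI : 0 < I) (hE : 0 < E) (hD : 0 < D)
    (hν : -1 < ν ∧ ν < 1)
    (Ax : Matrix (Fin 10) (Fin 10) ℝ)
    (hAx : Ax = !![0, 0, 0, 0, -1/ρ, 0, 0, 0, 0, 0;
    0, 0, 0, 0, 0, 0, -1/ρ, 0, 0, 0;
    0, 0, 0, 0, 0, 0, 0, -1/I, 0, 0;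
    0, 0, 0, 0, 0, 0, 0, 0, 0, -1/I;
    -E/(1-ν^2), 0, 0, 0, 0, 0, 0, 0, 0, 0;
    -E*ν/(1-ν^2), 0, 0, 0, 0, 0, 0, 0, 0, 0;
    0, -E/(4*(1+ν)), 0, 0, 0, 0, 0, 0, 0, 0;
    0, 0, -D, 0, 0, 0, 0, 0, 0, 0;
    0, 0, -D*ν, 0, 0, 0, 0, 0, 0, 0;
    0, 0, 0, -D*(1-ν)/2, 0, 0, 0, 0, 0, 0])
    (c₁ c₂ c₃ c₄ : ℝ)
    (hc₁ : c₁ = Real.sqrt (E / (ρ * (1 - ν^2))))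
    (hc₂ : c₂ = Real.sqrt (E / (4 * ρ * (1 + ν))))
    (hc₃ : c₃ = Real.sqrt (D / I))
    (hc₄ : c₄ = Real.sqrt (D * (1 - ν) / (2 * I))) :
    ((Ax.map (fun x => (x : ℂ))).charpoly).roots =
      {(c₁ : ℂ), (-c₁ : ℂ), (c₂ : ℂ), (-c₂ : ℂ), (c₃ : ℂ), (-c₃ : ℂ),
        (c₄ : ℂ), (-c₄ : ℂ), 0, 0} := by
  have e1 : 0 < 1 + ν := by linarith [hν.1]
  have e2 : 0 < 1 - ν := by linarith [hν.2]
  have e3 : 0 < 1 - ν^2 := by nlinarith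
  have k1 : (-1/ρ) * (-E/(1-ν^2)) = c₁ * c₁ := by
    rw [hc₁, Real.mul_self_sqrt (by positivity)]; field_simp
  have k2 : (-1/ρ) * (-E/(4*(1+ν))) = c₂ * c₂ := by
    rw [hc₂, Real.mul_self_sqrt (by positivity)]; field_simp
  have k3 : (-1/I) * (-D) = c₃ * c₃ := by
    rw [hc₃, Real.mul_self_sqrt (by positivity)]; field_simp
  have k4 : (-1/I) * (-D*(1-ν)/2) = c₄ * c₄ := by
    rw [hc₄, Real.mul_self_sqrt (by positivity)]; field_simp
  have key := kl_charpoly ((-1/ρ : ℝ) : ℂ) ((-1/ρ : ℝ) : ℂ) ((-1/I : ℝ) : ℂ) ((-1/I : ℝ) : ℂ)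
    ((-E/(1-ν^2) : ℝ) : ℂ) ((-E*ν/(1-ν^2) : ℝ) : ℂ) ((-E/(4*(1+ν)) : ℝ) : ℂ) ((-D : ℝ) : ℂ)
    ((-D*ν : ℝ) : ℂ) ((-D*(1-ν)/2 : ℝ) : ℂ) c₁ c₂ c₃ c₄
    (by exact_mod_cast k1) (by exact_mod_cast k2) (by exact_mod_cast k3) (by exact_mod_cast k4)
  rw [← Polynomial.roots_multiset_prod_X_sub_C
    ({(c₁ : ℂ), (-c₁ : ℂ), (c₂ : ℂ), (-c₂ : ℂ), (c₃ : ℂ), (-c₃ : ℂ),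
        (c₄ : ℂ), (-c₄ : ℂ), 0, 0} : Multiset ℂ), ← key, hAx]
  rw [kl_map]
end

section
/- For any unit direction (n_x, n_y) ∈ ℝ², the matrix n_x·A_x + n_y·A_y of the Kirchhoff–Love system has only real eigenvalues, i.e. the system ∂U/∂t + A_x ∂U/∂x + A_y ∂U/∂y = 0 is hyperbolic in every direction. -/
theorem quad_nonneg (ν a b : ℝ) (h1 : -1 < ν) (h2 : ν < 1) : 0 ≤ a^2 + 2*ν*a*b + b^2 := by
  nlinarith [mul_nonneg (by linarith : (0:ℝ) ≤ 1 + ν) (sq_nonneg (a+b)),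
    mul_nonneg (by linarith : (0:ℝ) ≤ 1 - ν) (sq_nonneg (a-b))]

theorem block_real (r c g ν nx ny : ℝ) (hr : 0 < r) (hc : 0 < c) (hg : 0 < g)
    (h1 : -1 < ν) (h2 : ν < 1) (z p q s u t : ℂ)
    (e1 : r * (z * p) = -(nx * s + ny * t)) (e2 : r * (z * q) = -(nx * t + ny * u))
    (e3 : z * s = -(c * (nx * p + ν * ny * q))) (e4 : z * u = -(c * (ν * nx * p + ny * q)))
    (e5 : z * t = -(g * (nx * q + ny * p))) : z.im = 0 ∨ (p = 0 ∧ q = 0) := by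
  have f1 : (r * z^2) * p = c * nx * (nx * p + ν * ny * q) + g * ny * (nx * q + ny * p) := by
    linear_combination z * e1 - nx * e3 - ny * e5
  have f2 : (r * z^2) * q = c * ny * (ν * nx * p + ny * q) + g * nx * (nx * q + ny * p) := by
    linear_combination z * e2 - ny * e4 - nx * e5
  obtain ⟨R, hR, hRe⟩ : ∃ R : ℝ, 0 ≤ R ∧
      (r * z^2) * ((p.re^2 + p.im^2 + q.re^2 + q.im^2 : ℝ) : ℂ) = R := by
    refine ⟨c * ((nx*p.re)^2 + 2*ν*(nx*p.re)*(ny*q.re) + (ny*q.re)^2)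
      + c * ((nx*p.im)^2 + 2*ν*(nx*p.im)*(ny*q.im) + (ny*q.im)^2)
      + g * ((nx*q.re+ny*p.re)^2 + (nx*q.im+ny*p.im)^2), ?_, ?_⟩
    · have := quad_nonneg ν (nx*p.re) (ny*q.re) h1 h2
      have := quad_nonneg ν (nx*p.im) (ny*q.im) h1 h2
      positivity
    · have hN : ((p.re^2 + p.im^2 + q.re^2 + q.im^2 : ℝ) : ℂ)
          = p * (starRingEnd ℂ) p + q * (starRingEnd ℂ) q := by
        apply Complex.ext <;> simp [pow_two] <;> ring
      rw [hN, mul_add, ← mul_assoc, ← mul_assoc, f1, f2]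
      apply Complex.ext <;> simp [pow_two] <;> ring
  by_cases hN : p.re^2 + p.im^2 + q.re^2 + q.im^2 = 0
  · right
    constructor <;> apply Complex.ext <;> simp <;> nlinarith [sq_nonneg p.re, sq_nonneg p.im, sq_nonneg q.re, sq_nonneg q.im]
  left
  have hNpos : 0 < p.re^2 + p.im^2 + q.re^2 + q.im^2 := lt_of_le_of_ne (by positivity) (Ne.symm hN)
  generalize p.re^2 + p.im^2 + q.re^2 + q.im^2 = N at *
  have a1 : r * (z.re^2 - z.im^2) * N = R := by
    have := congrArg Complex.re hRe
    simp [pow_two] at this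
    linarith
  have a2 : r * (2 * (z.re * z.im)) * N = 0 := by
    have := congrArg Complex.im hRe
    simp [pow_two] at this
    rcases this with (h | h) | h
    · exact absurd h hr.ne'
    · have : z.re * z.im = 0 := by linarith
      rw [this]; ring
    · exact absurd h hN
  have a3 : z.re * z.im = 0 := by
    simpa [hr.ne', hNpos.ne'] using a2
  by_contra him
  have hre : z.re = 0 := by simpa [him] using a3
  rw [hre] at a1
  have : 0 < r * z.im^2 * N := by positivity
  nlinarith


theorem stmt3 (ρ I E D ν : ℝ) (hρ : 0 < ρ) (hI : 0 < I) (hE : 0 < E) (hD : 0 < D)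
    (hν : -1 < ν ∧ ν < 1)
    (Ax Ay : Matrix (Fin 10) (Fin 10) ℝ)
    (hAx : Ax = !![0, 0, 0, 0, -1/ρ, 0, 0, 0, 0, 0;
    0, 0, 0, 0, 0, 0, -1/ρ, 0, 0, 0;
    0, 0, 0, 0, 0, 0, 0, -1/I, 0, 0;
    0, 0, 0, 0, 0, 0, 0, 0, 0, -1/I;
    -E/(1-ν^2), 0, 0, 0, 0, 0, 0, 0, 0, 0;
    -E*ν/(1-ν^2), 0, 0, 0, 0, 0, 0, 0, 0, 0;
    0, -E/(4*(1+ν)), 0, 0, 0, 0, 0, 0, 0, 0;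
    0, 0, -D, 0, 0, 0, 0, 0, 0, 0;
    0, 0, -D*ν, 0, 0, 0, 0, 0, 0, 0;
    0, 0, 0, -D*(1-ν)/2, 0, 0, 0, 0, 0, 0])
    (hAy : Ay = !![0, 0, 0, 0, 0, 0, -1/ρ, 0, 0, 0;
    0, 0, 0, 0, 0, -1/ρ, 0, 0, 0, 0;
    0, 0, 0, 0, 0, 0, 0, 0, 0, -1/I;
    0, 0, 0, 0, 0, 0, 0, 0, -1/I, 0;
    0, -E*ν/(1-ν^2), 0, 0, 0, 0, 0, 0, 0, 0;
    0, -E/(1-ν^2), 0, 0, 0, 0, 0, 0, 0, 0;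
    -E/(4*(1+ν)), 0, 0, 0, 0, 0, 0, 0, 0, 0;
    0, 0, 0, -D*ν, 0, 0, 0, 0, 0, 0;
    0, 0, 0, -D, 0, 0, 0, 0, 0, 0;
    0, 0, -D*(1-ν)/2, 0, 0, 0, 0, 0, 0, 0]) :
    ∀ nx ny : ℝ, nx^2 + ny^2 = 1 →
      ∀ z ∈ (((nx • Ax + ny • Ay).map (fun x => (x : ℂ))).charpoly).roots, z.im = 0 := by
  intro nx ny hn z hz
  obtain ⟨hν1, hν2⟩ := hν
  have hr := (Polynomial.mem_roots'.mp hz).2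
  rw [Polynomial.IsRoot, Matrix.eval_charpoly] at hr
  obtain ⟨v, hv0, hv⟩ := Matrix.exists_mulVec_eq_zero_iff.mpr hr
  have hρ' : (ρ : ℂ) ≠ 0 := by exact_mod_cast hρ.ne'
  have hI' : (I : ℂ) ≠ 0 := by exact_mod_cast hI.ne'
  have hM : ((nx • Ax + ny • Ay).map (fun x => (x : ℂ))).mulVec v = z • v := by
    rw [Matrix.sub_mulVec, sub_eq_zero] at hv
    rw [← hv]
    ext i
    simp [Matrix.scalar_apply, Matrix.mulVec_diagonal]
  have e := fun i => congrFun hM i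
  by_contra him
  have hz0 : z ≠ 0 := by rintro rfl; simp at him
  have hc : 0 < E/(1-ν^2) := div_pos hE (by nlinarith)
  have hg : 0 < E/(4*(1+ν)) := div_pos hE (by linarith)
  have hg2 : 0 < D*(1-ν)/2 := by
    have : 0 < 1 - ν := by linarith
    positivity
  subst hAx hAy
  have E0 := e 0
  have E1 := e 1
  have E2 := e 2
  have E3 := e 3
  have E4 := e 4
  have E5 := e 5
  have E6 := e 6
  have E7 := e 7
  have E8 := e 8
  have E9 := e 9
  clear e hM hv hr hz
  simp [Matrix.mulVec, dotProduct, Fin.sum_univ_succ] at E0 E1 E2 E3 E4 E5 E6 E7 E8 E9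
  have B1 := block_real ρ (E/(1-ν^2)) (E/(4*(1+ν))) ν nx ny hρ hc hg hν1 hν2 z
    (v 0) (v 1) (v 4) (v 5) (v 6)
    (by rw [← E0]; field_simp; ring) (by rw [← E1]; field_simp; ring)
    (by rw [← E4]; push_cast; ring) (by rw [← E5]; push_cast; ring)
    (by rw [← E6]; push_cast; ring)
  have B2 := block_real I D (D*(1-ν)/2) ν nx ny hI hD hg2 hν1 hν2 z
    (v 2) (v 3) (v 7) (v 8) (v 9)
    (by rw [← E2]; field_simp; ring) (by rw [← E3]; field_simp; ring)
    (by rw [← E7]; ring) (by rw [← E8]; ring)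
    (by rw [← E9]; push_cast; ring)
  obtain ⟨v0, v1⟩ := B1.resolve_left him
  obtain ⟨v2, v3⟩ := B2.resolve_left him
  simp [v0, v1, hz0] at E4 E5 E6
  simp [v2, v3, hz0] at E7 E8 E9
  apply hv0
  ext i
  fin_cases i <;> simp_all
end
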